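/- arXiv:2508.10087 — 5 statements merged into one kernel-verified Lean document; each statement's English description precedes it below -/
import Mathlib

section
/- Let m ≥ 1 be an integer, let r > 0 be real, and let α ∈ [0,1). Then the function z ↦ (Σ_{n∈ℤ} (n + r/(2m))·exp(−(2πz/(4m))·(2mn + r)²)) / √(z + α) is absolutely integrable on (0, ∞); in particular the integral I(α) = ∫₀^∞ (Σ_{n∈ℤ} (n + r/(2m))·exp(−(2πz/(4m))·(2mn+r)²)) / √(z+α) dz converges absolutely. (The defining sum over n ∈ ℤ converges absolutely for every z > 0.) -/
open MeasureTheory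

/-- For an integer `m ≥ 1`, real `r > 0` and `α ∈ [0,1)`, the function
`z ↦ (∑_{n∈ℤ} (n + r/(2m)) e^{−(2πz/(4m))(2mn+r)²}) / √(z+α)` is absolutely integrable on
`(0,∞)` (and the defining sum converges absolutely for every `z > 0`). -/
theorem stmt14 (m : ℕ) (hm : 1 ≤ m) (r : ℝ) (hr : 0 < r) (α : ℝ)
    (hα0 : 0 ≤ α) (hα1 : α < 1) :
    (∀ z ∈ Set.Ioi (0 : ℝ), Summable fun n : ℤ =>
      |((n : ℝ) + r / (2 * (m : ℝ))) *
        Real.exp (-(2 * Real.pi * z / (4 * (m : ℝ))) * (2 * (m : ℝ) * (n : ℝ) + r) ^ 2)|) ∧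
    IntegrableOn
      (fun z : ℝ =>
        (∑' n : ℤ, ((n : ℝ) + r / (2 * (m : ℝ))) *
          Real.exp (-(2 * Real.pi * z / (4 * (m : ℝ))) * (2 * (m : ℝ) * (n : ℝ) + r) ^ 2))
          / Real.sqrt (z + α))
      (Set.Ioi 0) := by
  have hm0 : (0 : ℝ) < m := by exact_mod_cast hm
  have hterm : ∀ z : ℝ, ∀ n : ℤ, ((n : ℝ) + r / (2 * (m : ℝ))) *
        Real.exp (-(2 * Real.pi * z / (4 * (m : ℝ))) * (2 * (m : ℝ) * (n : ℝ) + r) ^ 2) =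
      ((n : ℝ) + r / (2 * (m : ℝ))) *
        Real.exp (-Real.pi * ((n : ℝ) + r / (2 * (m : ℝ))) ^ 2 * (2 * m * z)) := by
    intro z n
    congr 2
    field_simp
    ring
  have hsum : ∀ z ∈ Set.Ioi (0 : ℝ), HasSum (fun n : ℤ => ((n : ℝ) + r / (2 * (m : ℝ))) *
        Real.exp (-(2 * Real.pi * z / (4 * (m : ℝ))) * (2 * (m : ℝ) * (n : ℝ) + r) ^ 2))
      (HurwitzZeta.oddKernel ((r / (2 * (m : ℝ)) : ℝ) : UnitAddCircle) (2 * m * z)) := by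
    intro z hz
    have hz' : 0 < z := hz
    simp_rw [hterm]
    exact HurwitzZeta.hasSum_int_oddKernel _ (by positivity)
  refine ⟨fun z hz => (hsum z hz).summable.abs, ?_⟩
  set a : UnitAddCircle := ((r / (2 * (m : ℝ)) : ℝ) : UnitAddCircle) with ha
  have hcongr : Set.EqOn (fun z : ℝ =>
      HurwitzZeta.oddKernel a (2 * m * z) / Real.sqrt (z + α)) (fun z : ℝ =>
        (∑' n : ℤ, ((n : ℝ) + r / (2 * (m : ℝ))) *
          Real.exp (-(2 * Real.pi * z / (4 * (m : ℝ))) * (2 * (m : ℝ) * (n : ℝ) + r) ^ 2))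
          / Real.sqrt (z + α)) (Set.Ioi 0) := by
    intro z hz
    simp only [(hsum z hz).tsum_eq]
  refine IntegrableOn.congr_fun ?_ hcongr measurableSet_Ioi
  have hM : MellinConvergent (fun z : ℝ => (HurwitzZeta.hurwitzOddFEPair a).f (2 * m * z))
      (1 / 2 : ℂ) :=
    (MellinConvergent.comp_mul_left (by positivity)).2
      ((HurwitzZeta.isStrong_hurwitzOddFEPair a).hasMellin _).1
  unfold MellinConvergent at hM
  refine Integrable.mono hM ?_ ?_
  · refine ContinuousOn.aestronglyMeasurable ?_ measurableSet_Ioi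
    refine ContinuousOn.div ?_ (by fun_prop) ?_
    · refine (HurwitzZeta.continuousOn_oddKernel a).comp (by fun_prop) ?_
      intro z hz
      have hz' : 0 < z := hz
      show 0 < 2 * (m : ℝ) * z
      positivity
    · intro z hz
      have hz' : 0 < z := hz
      positivity
  · refine (ae_restrict_iff' measurableSet_Ioi).2 (Filter.Eventually.of_forall ?_)
    intro z hz
    have hz' : 0 < z := hz
    have h1 : ‖(z : ℂ) ^ ((1 / 2 : ℂ) - 1)‖ = (Real.sqrt z)⁻¹ := by
      rw [Complex.norm_cpow_eq_rpow_re_of_pos hz', Real.sqrt_eq_rpow, ← Real.rpow_neg hz'.le]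
      norm_num
    rw [norm_smul, h1, norm_div, div_eq_inv_mul, Real.norm_of_nonneg (Real.sqrt_nonneg _)]
    simp only [HurwitzZeta.hurwitzOddFEPair_f, Function.comp, Complex.norm_real]
    gcongr
    linarith
end

section
/- Let m ≥ 1 be an integer and r > 0 real, and for α ∈ [0,1) let I(α) = ∫₀^∞ (Σ_{n∈ℤ} (n + r/(2m))·exp(−(2πz/(4m))·(2mn+r)²)) / √(z+α) dz. Then I(α) tends to I(0) as α → 0⁺; that is, the function α ↦ I(α) is right-continuous at α = 0. -/
open MeasureTheory Filter

/-- The integral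
`I(α) = ∫₀^∞ (∑_{n∈ℤ} (n + r/(2m)) e^{−(2πz/(4m))(2mn+r)²}) / √(z+α) dz`
is right-continuous at `α = 0`: `I(α) → I(0)` as `α → 0⁺`. -/
theorem stmt15 (m : ℕ) (hm : 1 ≤ m) (r : ℝ) (hr : 0 < r)
    (I : ℝ → ℝ)
    (hI : ∀ α : ℝ, I α = ∫ z in Set.Ioi (0 : ℝ),
      (∑' n : ℤ, ((n : ℝ) + r / (2 * (m : ℝ))) *
        Real.exp (-(2 * Real.pi * z / (4 * (m : ℝ))) * (2 * (m : ℝ) * (n : ℝ) + r) ^ 2))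
        / Real.sqrt (z + α)) :
    Tendsto I (nhdsWithin 0 (Set.Ioi 0)) (nhds (I 0)) := by
  have hm0 : (0 : ℝ) < m := by exact_mod_cast hm
  have hc : (0 : ℝ) < 2 * m := by positivity
  set a : ℝ := r / (2 * (m : ℝ)) with ha
  set K : ℝ → ℝ := HurwitzZeta.oddKernel (a : UnitAddCircle) with hK
  have hI' : ∀ α : ℝ, I α = ∫ z in Set.Ioi (0 : ℝ), K (2 * m * z) / Real.sqrt (z + α) := by
    intro α
    rw [hI]
    refine setIntegral_congr_fun measurableSet_Ioi fun z hz => ?_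
    have hz' : (0 : ℝ) < z := hz
    have h := (HurwitzZeta.hasSum_int_oddKernel a (x := 2 * m * z) (by positivity)).tsum_eq
    simp only [hK]
    rw [← h]
    congr 1
    refine tsum_congr fun n => ?_
    congr 2
    rw [ha]
    field_simp
    ring
  have hconv : MellinConvergent (fun t : ℝ => ((K (2 * m * t) : ℝ) : ℂ)) (1 / 2) :=
    (MellinConvergent.comp_mul_left (f := fun t : ℝ => ((K t : ℝ) : ℂ)) hc).2
      ((HurwitzZeta.isStrong_hurwitzOddFEPair (a : UnitAddCircle)).hasMellin (1 / 2)).1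
  have hcont : ContinuousOn (fun z : ℝ => K (2 * m * z)) (Set.Ioi 0) := by
    refine (HurwitzZeta.continuousOn_oddKernel (a : UnitAddCircle)).comp (by fun_prop) ?_
    intro z hz
    have hz' : (0 : ℝ) < z := hz
    show (0 : ℝ) < 2 * m * z
    positivity
  rw [hI' 0]
  refine Tendsto.congr (fun α => (hI' α).symm) ?_
  refine tendsto_integral_filter_of_dominated_convergence _ ?_ ?_ hconv.norm ?_
  · filter_upwards [self_mem_nhdsWithin] with α hα
    have hα' : (0 : ℝ) < α := hα
    refine ContinuousOn.aestronglyMeasurable ?_ measurableSet_Ioi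
    refine hcont.div (by fun_prop) fun z hz => ?_
    have hz' : (0 : ℝ) < z := hz
    positivity
  · filter_upwards [self_mem_nhdsWithin] with α hα
    have hα' : (0 : ℝ) < α := hα
    filter_upwards [ae_restrict_mem measurableSet_Ioi] with z hz
    have hz' : (0 : ℝ) < z := hz
    have hre : ((1 / 2 : ℂ) - 1).re = -(1 / 2 : ℝ) := by
      norm_num
    rw [norm_smul, Complex.norm_cpow_eq_rpow_re_of_pos hz', hre, Real.rpow_neg hz'.le,
      ← Real.sqrt_eq_rpow, Complex.norm_real, norm_div, div_eq_mul_inv, mul_comm,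
      Real.norm_of_nonneg (Real.sqrt_nonneg _)]
    gcongr
    linarith
  · filter_upwards [ae_restrict_mem measurableSet_Ioi] with z hz
    have hz' : (0 : ℝ) < z := hz
    have : ContinuousAt (fun α : ℝ => K (2 * m * z) / Real.sqrt (z + α)) 0 := by
      refine ContinuousAt.div (by fun_prop) (by fun_prop) ?_
      rw [add_zero]
      positivity
    exact this.tendsto.mono_left nhdsWithin_le_nhds
end

section
/- Let a > 0 and δ ∈ ℝ, and for z > 0 set S(z) = Σ_{n∈ℤ} (n + δ)·exp(−π a z (n + δ)²). Then: (i) there exist constants C > 0 and c > 0 such that |S(z)| ≤ C·z^{−3/2}·exp(−c/z) for all 0 < z ≤ 1; and (ii) there exist constants C' > 0 and c' > 0 such that |S(z)| ≤ C'·exp(−c' z) for all z ≥ 1. -/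
theorem aux_bound (f : ℝ → ℝ) (hf : ContinuousOn f (Set.Ioi 0)) (p b : ℝ) (hb : 0 < b)
    (h : Asymptotics.IsBigO Filter.atTop f (fun x ↦ Real.exp (-p * x))) :
    ∃ C > (0 : ℝ), ∀ x, b ≤ x → |f x| ≤ C * Real.exp (-p * x) := by
  obtain ⟨K, hK⟩ := h.bound
  obtain ⟨N, hN⟩ := Filter.eventually_atTop.1 hK
  have hc : ContinuousOn (fun x ↦ f x * Real.exp (p * x)) (Set.Icc b N) := by
    apply ContinuousOn.mul (hf.mono fun x hx ↦ lt_of_lt_of_le hb hx.1)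
    fun_prop
  obtain ⟨M, hM⟩ := isCompact_Icc.exists_bound_of_continuousOn hc
  refine ⟨max 1 (max K M), by positivity, fun x hx ↦ ?_⟩
  rcases le_total N x with h1 | h1
  · have := hN x h1
    rw [Real.norm_eq_abs, Real.norm_eq_abs, Real.abs_exp] at this
    refine this.trans ?_
    gcongr
    exact (le_max_left _ _).trans (le_max_right _ _)
  · have := hM x ⟨hx, h1⟩
    rw [Real.norm_eq_abs, abs_mul, Real.abs_exp] at this
    have e : |f x| = |f x| * Real.exp (p * x) * Real.exp (-p * x) := by
      rw [mul_assoc, ← Real.exp_add]; simp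
    rw [e]
    gcongr
    exact this.trans ((le_max_right _ _).trans (le_max_right _ _))

theorem aux_sum (a δ : ℝ) (ha : 0 < a) (z : ℝ) (hz : 0 < z) :
    ∑' n : ℤ, ((n : ℝ) + δ) * Real.exp (-Real.pi * a * z * ((n : ℝ) + δ) ^ 2)
      = HurwitzZeta.oddKernel (δ : UnitAddCircle) (a * z) := by
  rw [← (HurwitzZeta.hasSum_int_oddKernel δ (mul_pos ha hz)).tsum_eq]
  congr 1
  ext n
  congr 2
  ring

/-- For `a > 0`, `δ ∈ ℝ`, and
`S(z) = ∑_{n∈ℤ} (n+δ) e^{−π a z (n+δ)²}`: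
(i) `|S(z)| ≤ C z^{−3/2} e^{−c/z}` on `0 < z ≤ 1`;
(ii) `|S(z)| ≤ C' e^{−c'z}` on `z ≥ 1`. -/
theorem stmt16 (a δ : ℝ) (ha : 0 < a) :
    (∃ C > (0 : ℝ), ∃ c > (0 : ℝ), ∀ z : ℝ, 0 < z → z ≤ 1 →
      |∑' n : ℤ, ((n : ℝ) + δ) * Real.exp (-Real.pi * a * z * ((n : ℝ) + δ) ^ 2)|
        ≤ C * z ^ (-(3 : ℝ) / 2) * Real.exp (-c / z)) ∧
    (∃ C' > (0 : ℝ), ∃ c' > (0 : ℝ), ∀ z : ℝ, 1 ≤ z →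
      |∑' n : ℤ, ((n : ℝ) + δ) * Real.exp (-Real.pi * a * z * ((n : ℝ) + δ) ^ 2)|
        ≤ C' * Real.exp (-c' * z)) := by
  constructor
  · obtain ⟨p, hp, hO⟩ := HurwitzZeta.isBigO_atTop_sinKernel (δ : UnitAddCircle)
    obtain ⟨C, hC, h⟩ := aux_bound _ (HurwitzZeta.continuousOn_sinKernel _) p (1 / a)
      (by positivity) hO
    refine ⟨1 / a ^ (3 / 2 : ℝ) * C, by positivity, p / a, by positivity, fun z hz hz1 ↦ ?_⟩
    rw [aux_sum a δ ha z hz, HurwitzZeta.oddKernel_functional_equation, abs_mul,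
      abs_of_nonneg (by positivity), Real.mul_rpow ha.le hz.le]
    have h2 := h (1 / (a * z)) (by
      apply one_div_le_one_div_of_le (by positivity)
      nlinarith)
    have e1 : z ^ (-(3 : ℝ) / 2) = 1 / z ^ (3 / 2 : ℝ) := by
      rw [neg_div, Real.rpow_neg hz.le, one_div]
    have e2 : -(p / a) / z = -p * (1 / (a * z)) := by field_simp
    rw [e1, e2]
    calc _ ≤ 1 / (a ^ (3 / 2 : ℝ) * z ^ (3 / 2 : ℝ)) * (C * Real.exp (-p * (1 / (a * z)))) := by
          gcongr
      _ = _ := by rw [one_div_mul_eq_div, ← one_div_mul_one_div, div_eq_mul_one_div,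
                    ← one_div_mul_one_div]; ring
  · obtain ⟨p, hp, hO⟩ := HurwitzZeta.isBigO_atTop_oddKernel (δ : UnitAddCircle)
    obtain ⟨C, hC, h⟩ := aux_bound _ (HurwitzZeta.continuousOn_oddKernel _) p a ha hO
    refine ⟨C, hC, p * a, by positivity, fun z hz ↦ ?_⟩
    rw [aux_sum a δ ha z (by linarith)]
    have h2 := h (a * z) (by nlinarith)
    rwa [show -(p * a) * z = -p * (a * z) by ring]
end

section
/- For all real α > 0 and β > 0, ∫_α^∞ e^{−β/x} · x^{−3/2} · (x + α)^{−1/2} dx = (2/√(αβ)) · e^{β/α} · ∫_{√(β/α)}^{√(2β/α)} e^{−t²} dt. Equivalently, in terms of the complementary error function Erfc(u) = (2/√π)∫_u^∞ e^{−t²} dt, the left-hand side equals √(π/(αβ)) · e^{β/α} · (Erfc(√(β/α)) − Erfc(√(2β/α))). -/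
lemma aux_image (α β : ℝ) (hα : 0 < α) (hβ : 0 < β) :
    (fun x : ℝ => Real.sqrt (β / α + β / x)) '' Set.Ioi α =
      Set.Ioo (Real.sqrt (β / α)) (Real.sqrt (2 * β / α)) := by
  ext u
  simp only [Set.mem_image, Set.mem_Ioi, Set.mem_Ioo]
  constructor
  · rintro ⟨x, hx, rfl⟩
    have hx0 : 0 < x := hα.trans hx
    constructor
    · apply Real.sqrt_lt_sqrt (by positivity)
      have : 0 < β / x := by positivity
      linarith
    · apply Real.sqrt_lt_sqrt (by positivity)
      have h1 : β / x < β / α := div_lt_div_of_pos_left hβ hα hx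
      have h2 : 2 * β / α = β / α + β / α := by ring
      linarith
  · rintro ⟨h1, h2⟩
    have hu0 : 0 < u := lt_of_le_of_lt (Real.sqrt_nonneg _) h1
    have h1' : β / α < u ^ 2 := (Real.sqrt_lt' hu0).1 h1
    have h2' : u ^ 2 < 2 * β / α := (Real.lt_sqrt hu0.le).1 h2
    have h3 : 2 * β / α = β / α + β / α := by ring
    have hd : 0 < u ^ 2 - β / α := by linarith
    refine ⟨β / (u ^ 2 - β / α), ?_, ?_⟩
    · rw [lt_div_iff₀ hd]
      have h4 : u ^ 2 - β / α < β / α := by linarith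
      calc α * (u ^ 2 - β / α) < α * (β / α) := mul_lt_mul_of_pos_left h4 hα
        _ = β := by field_simp
    · have : β / α + β / (β / (u ^ 2 - β / α)) = u ^ 2 := by
        rw [div_div_cancel₀ hβ.ne']; ring
      rw [this, Real.sqrt_sq hu0.le]

/-- For `α, β > 0`,
`∫_α^∞ e^{−β/x} x^{−3/2} (x+α)^{−1/2} dx
 = (2/√(αβ)) e^{β/α} ∫_{√(β/α)}^{√(2β/α)} e^{−t²} dt`. -/
theorem stmt18 (α β : ℝ) (hα : 0 < α) (hβ : 0 < β) :
    (∫ x in Set.Ioi α,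
        Real.exp (-β / x) * x ^ (-(3 : ℝ) / 2) * (x + α) ^ (-(1 : ℝ) / 2))
      = (2 / Real.sqrt (α * β)) * Real.exp (β / α) *
          ∫ u in Real.sqrt (β / α)..Real.sqrt (2 * β / α), Real.exp (-u ^ 2) := by
  have hle : Real.sqrt (β / α) ≤ Real.sqrt (2 * β / α) := by
    apply Real.sqrt_le_sqrt
    gcongr
    linarith
  rw [intervalIntegral.integral_of_le hle, MeasureTheory.integral_Ioc_eq_integral_Ioo,
    ← aux_image α β hα hβ,
    MeasureTheory.integral_image_eq_integral_abs_deriv_smul (f' := fun x =>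
      (-β / x ^ 2) / (2 * Real.sqrt (β / α + β / x))) measurableSet_Ioi,
    ← MeasureTheory.integral_const_mul]
  · apply MeasureTheory.setIntegral_congr_fun measurableSet_Ioi
    intro x hx
    have hx0 : 0 < x := hα.trans hx
    have hs : Real.sqrt (β / α + β / x) =
        Real.sqrt (α * β) * Real.sqrt (x + α) / (α * Real.sqrt x) := by
      rw [Real.sqrt_eq_iff_mul_self_eq (by positivity) (by positivity)]
      have e1 := Real.mul_self_sqrt (show 0 ≤ α * β by positivity)
      have e2 := Real.mul_self_sqrt (show 0 ≤ x + α by positivity)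
      have e3 := Real.mul_self_sqrt hx0.le
      rw [div_mul_div_comm, mul_mul_mul_comm, e1, e2, mul_mul_mul_comm, e3]
      field_simp
    have h1 : (x + α) ^ (-(1 : ℝ) / 2) = 1 / Real.sqrt (x + α) := by
      rw [neg_div, Real.rpow_neg (by positivity), ← Real.sqrt_eq_rpow, one_div]
    have h2 : x ^ (-(3 : ℝ) / 2) = Real.sqrt x / x ^ 2 := by
      rw [Real.sqrt_eq_rpow, ← Real.rpow_natCast, ← Real.rpow_sub hx0]
      norm_num
    have h3 : Real.exp (-(Real.sqrt (β / α + β / x)) ^ 2) =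
        Real.exp (-β / x) / Real.exp (β / α) := by
      rw [Real.sq_sqrt (by positivity), ← Real.exp_sub]
      congr 1
      ring
    have h4 : |(-β / x ^ 2) / (2 * Real.sqrt (β / α + β / x))| =
        (β / x ^ 2) / (2 * Real.sqrt (β / α + β / x)) := by
      rw [neg_div, neg_div, abs_neg, abs_of_nonneg (by positivity)]
    simp only [smul_eq_mul]
    rw [h4, h3, h1, h2, hs]
    have p1 : 0 < Real.sqrt (α * β) := by positivity
    have p2 : 0 < Real.sqrt (x + α) := by positivity
    have p3 : 0 < Real.sqrt x := by positivity
    have e1 := Real.sq_sqrt (show 0 ≤ α * β by positivity)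
    generalize Real.sqrt (α * β) = s at *
    generalize Real.sqrt (x + α) = t at *
    field_simp
    linarith
  · intro x hx
    have hx0 : 0 < x := hα.trans hx
    have hd : HasDerivAt (fun x : ℝ => β / α + β / x) (-β / x ^ 2) x := by
      have := ((hasDerivAt_inv hx0.ne').const_mul β).const_add (β / α)
      have e : -β / x ^ 2 = β * (-(x ^ 2)⁻¹) := by ring
      rw [e]
      exact this
    exact (hd.sqrt (by positivity)).hasDerivWithinAt
  · intro x hx y hy hxy
    have hx0 : 0 < x := hα.trans hx
    have hy0 : 0 < y := hα.trans hy
    have h := (Real.sqrt_inj (by positivity) (by positivity)).1 hxy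
    have h' : β / x = β / y := by linarith
    field_simp at h'
    exact h'.symm
end

section
/- Let s, t ≥ 2 and r ≥ 1 be integers with st ≥ 3, let α₁ be an integer with 1 ≤ α₁ ≤ 2st(rst+1) − 1, let α₂ be an integer with 0 ≤ α₂ ≤ 2r, and suppose δ := (2α₂+1)/(2(2r+1)) − α₁/(2(rst+1)) ≠ 0. For (ℓ₁, ℓ₂) ∈ ℤ² define R(ℓ₁, ℓ₂) = (2r+1)·(−⌊(1/2)·((2α₂+1)/(2r+1) − α₁/(rst+1))⌋ + ℓ₁·st + ℓ₂ + (2α₂+1)/(2(2r+1)))² − 2st(rst+1)·(ℓ₁ + α₁/(2st(rst+1)))². Then for every (ℓ₁, ℓ₂) ∈ ℤ² belonging to the double cone {(ℓ₁, ℓ₂) : ℓ₁ ≥ 0 and ℓ₂ ≥ 0} ∪ {(ℓ₁, ℓ₂) : ℓ₁ ≤ −1 and ℓ₂ ≤ −1}, one has R(ℓ₁, ℓ₂) ≥ min(R(0,0), R(−1,−1)). In particular, the minimum of the quadratic exponent R over the summation cone of the indefinite theta series Θ_{A, μ+b, b, c₁, c₂} is attained at (ℓ₁, ℓ₂) = (0,0)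 or (ℓ₁, ℓ₂) = (−1,−1), so the leading q̃-power of the indefinite theta function is min(R(0,0), R(−1,−1)). -/
/-- The `q`-exponent `R(ℓ₁, ℓ₂)` of the indefinite theta series
`Θ_{A, μ+b, b, c₁, c₂}` for `A = diag(−2st(rst+1), 2r+1)`, after the change of summation
variables described in the paper. -/
def Rexp (s t r α₁ α₂ : ℤ) (l₁ l₂ : ℤ) : ℚ :=
  (2 * (r : ℚ) + 1) *
      (-((⌊(1 / 2 : ℚ) * ((2 * (α₂ : ℚ) + 1) / (2 * (r : ℚ) + 1)
            - (α₁ : ℚ) / ((r : ℚ) * (s : ℚ) * (t : ℚ) + 1))⌋ : ℚ))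
        + (l₁ : ℚ) * ((s : ℚ) * (t : ℚ)) + (l₂ : ℚ)
        + (2 * (α₂ : ℚ) + 1) / (2 * (2 * (r : ℚ) + 1))) ^ 2
    - 2 * (s : ℚ) * (t : ℚ) * ((r : ℚ) * (s : ℚ) * (t : ℚ) + 1) *
        ((l₁ : ℚ) + (α₁ : ℚ) / (2 * (s : ℚ) * (t : ℚ) *
          ((r : ℚ) * (s : ℚ) * (t : ℚ) + 1))) ^ 2

theorem Rexp_eq (s t r α₁ α₂ : ℤ) (hs : 2 ≤ s) (ht : 2 ≤ t) (hr : 1 ≤ r) (l₁ l₂ : ℤ) :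
    ∃ f a : ℚ, 0 ≤ f ∧ f < 1 ∧
      a = (α₁ : ℚ) / (2 * (s : ℚ) * (t : ℚ) * ((r : ℚ) * (s : ℚ) * (t : ℚ) + 1)) ∧
      f = Int.fract ((1 / 2 : ℚ) * ((2 * (α₂ : ℚ) + 1) / (2 * (r : ℚ) + 1)
            - (α₁ : ℚ) / ((r : ℚ) * (s : ℚ) * (t : ℚ) + 1))) ∧
      Rexp s t r α₁ α₂ l₁ l₂ =
        ((s : ℚ) * t) * ((s : ℚ) * t - 2) * (l₁ + a) ^ 2
        + 2 * (2 * (r : ℚ) + 1) * ((s : ℚ) * t) * ((l₁ + a) * (l₂ + f))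
        + (2 * (r : ℚ) + 1) * (l₂ + f) ^ 2 := by
  refine ⟨_, _, Int.fract_nonneg _, Int.fract_lt_one _, rfl, rfl, ?_⟩
  unfold Rexp Int.fract
  have hs' : (2 : ℚ) ≤ s := by exact_mod_cast hs
  have ht' : (2 : ℚ) ≤ t := by exact_mod_cast ht
  have hr' : (1 : ℚ) ≤ r := by exact_mod_cast hr
  have hN : (r : ℚ) * s * t + 1 ≠ 0 := by positivity
  have hK : 2 * (r : ℚ) + 1 ≠ 0 := by positivity
  have hs0 : (s : ℚ) ≠ 0 := by positivity
  have ht0 : (t : ℚ) ≠ 0 := by positivity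
  generalize (⌊(1 / 2 : ℚ) * ((2 * (α₂ : ℚ) + 1) / (2 * (r : ℚ) + 1)
            - (α₁ : ℚ) / ((r : ℚ) * (s : ℚ) * (t : ℚ) + 1))⌋ : ℚ) = F
  field_simp
  ring

theorem quad_mono (A B C x y x' y' : ℚ) (hA : 0 ≤ A) (hB : 0 ≤ B) (hC : 0 ≤ C)
    (hx : 0 ≤ x) (hy : 0 ≤ y) (hx' : x ≤ x') (hy' : y ≤ y') :
    A * x ^ 2 + B * (x * y) + C * y ^ 2 ≤ A * x' ^ 2 + B * (x' * y') + C * y' ^ 2 := by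
  have : 0 ≤ x' := hx.trans hx'
  gcongr

/-- On the double cone `{ℓ₁ ≥ 0, ℓ₂ ≥ 0} ∪ {ℓ₁ ≤ −1, ℓ₂ ≤ −1}` the
quadratic exponent `R` is bounded below by `min(R(0,0), R(−1,−1))`, so the leading
`q̃`-power of the indefinite theta function is attained at `(0,0)` or `(−1,−1)`. -/
theorem stmt19 (s t r : ℤ) (hs : 2 ≤ s) (ht : 2 ≤ t) (hr : 1 ≤ r) (hst : 3 ≤ s * t)
    (α₁ α₂ : ℤ) (hα₁ : 1 ≤ α₁) (hα₁' : α₁ ≤ 2 * s * t * (r * s * t + 1) - 1)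
    (hα₂ : 0 ≤ α₂) (hα₂' : α₂ ≤ 2 * r)
    (hδ : (2 * (α₂ : ℚ) + 1) / (2 * (2 * (r : ℚ) + 1))
        - (α₁ : ℚ) / (2 * ((r : ℚ) * (s : ℚ) * (t : ℚ) + 1)) ≠ 0) :
    ∀ l₁ l₂ : ℤ, ((0 ≤ l₁ ∧ 0 ≤ l₂) ∨ (l₁ ≤ -1 ∧ l₂ ≤ -1)) →
      min (Rexp s t r α₁ α₂ 0 0) (Rexp s t r α₁ α₂ (-1) (-1)) ≤ Rexp s t r α₁ α₂ l₁ l₂ := by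
  intro l₁ l₂ h
  obtain ⟨f, a, hf0, hf1, ha, hf, h1⟩ := Rexp_eq s t r α₁ α₂ hs ht hr l₁ l₂
  obtain ⟨f', a', -, -, ha', hf', h2⟩ := Rexp_eq s t r α₁ α₂ hs ht hr 0 0
  obtain ⟨f'', a'', -, -, ha'', hf'', h3⟩ := Rexp_eq s t r α₁ α₂ hs ht hr (-1) (-1)
  rw [← ha] at ha' ha''
  rw [← hf] at hf' hf''
  subst ha' ha'' hf' hf''
  have hs' : (2 : ℚ) ≤ s := by exact_mod_cast hs
  have ht' : (2 : ℚ) ≤ t := by exact_mod_cast ht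
  have hr' : (1 : ℚ) ≤ r := by exact_mod_cast hr
  have hm : (3 : ℚ) ≤ s * t := by exact_mod_cast hst
  have hα : (1 : ℚ) ≤ α₁ := by exact_mod_cast hα₁
  have hα' : (α₁ : ℚ) ≤ 2 * s * t * (r * s * t + 1) - 1 := by exact_mod_cast hα₁'
  have hD : (0 : ℚ) < 2 * s * t * (r * s * t + 1) := by positivity
  have ha0 : 0 ≤ a'' := by rw [ha]; positivity
  have ha1 : a'' ≤ 1 := by rw [ha, div_le_one hD]; linarith
  have hA : (0 : ℚ) ≤ ((s : ℚ) * t) * ((s : ℚ) * t - 2) :=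
    mul_nonneg (by linarith) (by linarith)
  have hB : (0 : ℚ) ≤ 2 * (2 * (r : ℚ) + 1) * ((s : ℚ) * t) := by positivity
  have hC : (0 : ℚ) ≤ 2 * (r : ℚ) + 1 := by positivity
  rcases h with ⟨p, q⟩ | ⟨p, q⟩
  · apply min_le_of_left_le
    have p' : (0 : ℚ) ≤ l₁ := by exact_mod_cast p
    have q' : (0 : ℚ) ≤ l₂ := by exact_mod_cast q
    rw [h1, h2]
    push_cast
    exact quad_mono _ _ _ _ _ _ _ hA hB hC (by linarith) (by linarith) (by linarith)
      (by linarith)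
  · apply min_le_of_right_le
    have p' : (l₁ : ℚ) ≤ -1 := by exact_mod_cast p
    have q' : (l₂ : ℚ) ≤ -1 := by exact_mod_cast q
    rw [h1, h3]
    push_cast
    have := quad_mono _ _ _ (1 - a'') (1 - f'') (-(l₁ + a'')) (-(l₂ + f'')) hA hB hC
      (by linarith) (by linarith) (by linarith) (by linarith)
    linarith
end
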